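/- Define T : ℕ → ℕ → ℕ by: T(ℓ, 1) = 1 for all ℓ ≥ 1; T(ℓ, n) = 0 whenever n = 0, or n ≥ 2 and ℓ ≤ n; and for ℓ > n ≥ 2, T(ℓ, n) = S(ℓ−1, n) + Σ_{j=0}^{ℓ−2} Σ_{m=0}^{n−2} S(j, m) · T(ℓ−j−1, n−m) · (n−m−1). Then for all ℓ > n ≥ 1, the number of surjective words ω : Fin ℓ → Fin n whose word-graph G_ω is strongly connected equals n! · T(ℓ, n). -/

import Mathlib

/-- The edge relation of the word-graph of `ω`: ordered pairs of distinct adjacent letters. -/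
def WordEdge {ℓ : ℕ} {α : Type*} (ω : Fin ℓ → α) (a b : α) : Prop :=
  a ≠ b ∧ ∃ i : ℕ, ∃ h : i + 1 < ℓ, ω ⟨i, Nat.lt_of_succ_lt h⟩ = a ∧ ω ⟨i + 1, h⟩ = b

/-- The word-graph of `ω` is strongly connected. -/
def StronglyConnectedWord {ℓ : ℕ} {α : Type*} (ω : Fin ℓ → α) : Prop :=
  ∀ a ∈ Set.range ω, ∀ b ∈ Set.range ω, Relation.ReflTransGen (WordEdge ω) a b

/-- An `n`-partition of `Fin ℓ` is reducible if some nonempty proper subset of its blocks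
has union `{i : Fin ℓ | (i : ℕ) < j}` for some `1 ≤ j < ℓ`. -/
def Reducible {ℓ : ℕ} (P : Finpartition (Finset.univ : Finset (Fin ℓ))) : Prop :=
  ∃ j : ℕ, 1 ≤ j ∧ j < ℓ ∧ ∃ B : Finset (Finset (Fin ℓ)),
    B.Nonempty ∧ B ⊂ P.parts ∧ B.sup id = Finset.univ.filter (fun i : Fin ℓ => (i : ℕ) < j)

/-- `S ℓ n`: the number of `n`-partitions of `Fin ℓ` (Stirling number of the second kind). -/
noncomputable def S (ℓ n : ℕ) : ℕ :=
  Nat.card {P : Finpartition (Finset.univ : Finset (Fin ℓ)) // P.parts.card = n}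

/-- `I ℓ n`: the number of irreducible `n`-partitions of `Fin ℓ`. -/
noncomputable def I (ℓ n : ℕ) : ℕ :=
  Nat.card {P : Finpartition (Finset.univ : Finset (Fin ℓ)) // P.parts.card = n ∧ ¬ Reducible P}

open Finset in
theorem card_surj_eq {β : Type} [Fintype β] [DecidableEq β] (j : ℕ) :
    Nat.card {f : Fin j → β // Function.Surjective f} =
      (Fintype.card β).factorial * S j (Fintype.card β) := by
  classical
  let X := {P : Finpartition (Finset.univ : Finset (Fin j)) // P.parts.card = Fintype.card β}
  let Φ : (Σ P : X, (P.1.parts ≃ β)) → {f : Fin j → β // Function.Surjective f} :=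
    fun x => ⟨fun i => x.2 ⟨x.1.1.part i, by simp⟩, by
      intro b
      obtain ⟨⟨p, hp⟩, rfl⟩ := x.2.surjective b
      obtain ⟨i, hi⟩ := x.1.1.nonempty_of_mem_parts hp
      refine ⟨i, ?_⟩
      exact congrArg x.2 (Subtype.ext (x.1.1.part_eq_of_mem hp hi))⟩
  have hinj : Function.Injective Φ := by
    rintro ⟨⟨P, hP⟩, e⟩ ⟨⟨Q, hQ⟩, e'⟩ h
    have h1 : ∀ i, e ⟨P.part i, by simp⟩ = e' ⟨Q.part i, by simp⟩ := by
      intro i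
      exact congrFun (congrArg Subtype.val h) i
    have h2 : ∀ i, P.part i = Q.part i := by
      intro i
      ext k
      rw [P.mem_part_iff_part_eq_part (by simp) (by simp),
        Q.mem_part_iff_part_eq_part (by simp) (by simp)]
      constructor
      · intro hk
        have : e ⟨P.part k, by simp⟩ = e ⟨P.part i, by simp⟩ := by congr 1; exact Subtype.ext hk
        rw [h1, h1] at this
        exact congrArg Subtype.val (e'.injective this)
      · intro hk
        have : e' ⟨Q.part k, by simp⟩ = e' ⟨Q.part i, by simp⟩ := by congr 1; exact Subtype.ext hk
        rw [← h1, ← h1] at this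
        exact congrArg Subtype.val (e.injective this)
    have hsub : ∀ P Q : Finpartition (Finset.univ : Finset (Fin j)),
        (∀ i, P.part i = Q.part i) → ∀ p ∈ P.parts, p ∈ Q.parts := by
      intro P Q h p hp
      obtain ⟨i, hi⟩ := P.nonempty_of_mem_parts hp
      rw [← P.part_eq_of_mem hp hi, h]
      simp
    have h3 : P = Q := by
      ext p
      exact ⟨hsub P Q h2 p, hsub Q P (fun i => (h2 i).symm) p⟩
    subst h3
    have h4 : e = e' := by
      ext ⟨p, hp⟩
      obtain ⟨i, hi⟩ := P.nonempty_of_mem_parts hp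
      have := h1 i
      simp only [P.part_eq_of_mem hp hi] at this
      exact this
    subst h4
    rfl
  have hsurj : Function.Surjective Φ := by
    rintro ⟨f, hf⟩
    let P : Finpartition (Finset.univ : Finset (Fin j)) := Finpartition.ofSetoid (Setoid.ker f)
    have hpart : ∀ i, P.part i = univ.filter (fun k => f k = f i) := by
      intro i
      ext k
      simp only [P, Finpartition.mem_part_ofSetoid_iff_rel, mem_filter, mem_univ, true_and]
      rw [Setoid.ker_def]
      exact eq_comm
    have hmem : ∀ b, univ.filter (fun k => f k = b) ∈ P.parts := by
      intro b
      obtain ⟨i, rfl⟩ := hf b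
      rw [← hpart]
      simp
    let g : β → P.parts := fun b => ⟨univ.filter (fun k => f k = b), hmem b⟩
    have hg : Function.Bijective g := by
      constructor
      · intro b c hbc
        obtain ⟨i, rfl⟩ := hf b
        have := congrArg Subtype.val hbc
        have hi : i ∈ univ.filter (fun k => f k = f i) := by simp
        simp only [g] at this
        rw [this] at hi
        simpa using hi
      · rintro ⟨p, hp⟩
        obtain ⟨i, hi⟩ := P.nonempty_of_mem_parts hp
        refine ⟨f i, Subtype.ext ?_⟩
        simp only [g]
        rw [← hpart, P.part_eq_of_mem hp hi]
    let e : β ≃ P.parts := Equiv.ofBijective g hg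
    refine ⟨⟨⟨P, ?_⟩, e.symm⟩, ?_⟩
    · rw [← Fintype.card_coe]
      exact (Fintype.card_congr e).symm
    · apply Subtype.ext
      funext i
      simp only [Φ]
      rw [Equiv.symm_apply_eq]
      exact Subtype.ext (hpart i)
  rw [← Nat.card_eq_of_bijective Φ ⟨hinj, hsurj⟩, Nat.card_sigma]
  rw [Finset.sum_congr rfl (g := fun _ => (Fintype.card β).factorial)]
  · rw [Finset.sum_const, smul_eq_mul, mul_comm, S, Finset.card_univ, Nat.card_eq_fintype_card]
  · rintro ⟨P, hP⟩ _
    have e : P.parts ≃ β := Fintype.equivOfCardEq (by rw [Fintype.card_coe, hP])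
    rw [Nat.card_eq_fintype_card, Fintype.card_equiv e, Fintype.card_coe, hP]

/-- Irreducible lists: no splitting into two nonempty pieces with disjoint alphabets. -/
def Irr {α : Type} (l : List α) : Prop :=
  ∀ u v : List α, u ≠ [] → v ≠ [] → l = u ++ v → ∃ x, x ∈ u ∧ x ∈ v

theorem irr_cons {α : Type} (a : α) (u v : List α) (hv : v ≠ []) (hi : Irr v)
    (hd : List.Disjoint u v) : Irr (a :: (u ++ v)) ↔ a ∈ v := by
  constructor
  · intro h
    obtain ⟨x, hx, hx'⟩ := h (a :: u) v (by simp) hv (by simp)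
    rcases List.mem_cons.1 hx with rfl | hx
    · exact hx'
    · exact absurd hx' (fun h => hd hx h)
  · intro ha p q hp hq h
    cases p with
    | nil => exact absurd rfl hp
    | cons b p =>
      rw [List.cons_append, List.cons.injEq] at h
      obtain ⟨rfl, h⟩ := h
      rcases List.append_eq_append_iff.1 h with ⟨s, rfl, rfl⟩ | ⟨s, rfl, rfl⟩
      · by_cases hs : s = []
        · subst hs
          exact ⟨a, by simp, by simpa using ha⟩
        · obtain ⟨x, hx, hx'⟩ := hi s q hs hq rfl
          exact ⟨x, by simp [hx], hx'⟩
      · exact ⟨a, by simp, by simp [ha]⟩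

theorem exists_split {α : Type} (w : List α) (hw : w ≠ []) :
    ∃ u v : List α, w = u ++ v ∧ v ≠ [] ∧ Irr v ∧ List.Disjoint u v := by
  induction w with
  | nil => exact absurd rfl hw
  | cons a w ih =>
    by_cases h : w = []
    · subst h
      refine ⟨[], [a], rfl, by simp, ?_, by simp⟩
      intro u v hu hv h
      have := congrArg List.length h
      have h1 := List.length_pos_iff.2 hu
      have h2 := List.length_pos_iff.2 hv
      simp at this
      omega
    · obtain ⟨u, v, rfl, hv, hi, hd⟩ := ih h
      by_cases ha : a ∈ v
      · exact ⟨[], a :: (u ++ v), rfl, by simp, (irr_cons a u v hv hi hd).2 ha, by simp⟩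
      · refine ⟨a :: u, v, rfl, hv, hi, ?_⟩
        simp [ha, hd]

theorem split_unique {α : Type} (u v u' v' : List α) (h : u ++ v = u' ++ v')
    (hv : v ≠ []) (hi : Irr v) (hd : List.Disjoint u v)
    (hv' : v' ≠ []) (hi' : Irr v') (hd' : List.Disjoint u' v') : u = u' ∧ v = v' := by
  rcases List.append_eq_append_iff.1 h with ⟨s, rfl, rfl⟩ | ⟨s, rfl, rfl⟩
  · by_cases hs : s = []
    · subst hs; simp
    · obtain ⟨x, hx, hx'⟩ := hi s v' hs hv' rfl
      exact absurd hx' (fun h => hd' (by simp [hx]) h)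
  · by_cases hs : s = []
    · subst hs; simp
    · obtain ⟨x, hx, hx'⟩ := hi' s v hs hv rfl
      exact absurd hx' (fun h => hd (by simp [hx]) h)

open Classical in
/-- Words of length `ℓ` with alphabet exactly `A`. -/
noncomputable def Wd {α : Type} [Fintype α] (ℓ : ℕ) (A : Finset α) : Finset (List α) :=
  (List.finite_length_eq α ℓ).toFinset.filter (fun l => l.toFinset = A)

open Classical in
/-- Irreducible words of length `ℓ` with alphabet exactly `A`. -/
noncomputable def Wi {α : Type} [Fintype α] (ℓ : ℕ) (A : Finset α) : Finset (List α) :=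
  (Wd ℓ A).filter Irr

theorem mem_Wd {α : Type} [Fintype α] {ℓ : ℕ} {A : Finset α} {l : List α} :
    l ∈ Wd ℓ A ↔ l.length = ℓ ∧ ∀ x, x ∈ l ↔ x ∈ A := by
  classical
  simp [Wd, Finset.ext_iff]

theorem mem_Wi {α : Type} [Fintype α] {ℓ : ℕ} {A : Finset α} {l : List α} :
    l ∈ Wi ℓ A ↔ (l.length = ℓ ∧ ∀ x, x ∈ l ↔ x ∈ A) ∧ Irr l := by
  classical
  simp [Wi, mem_Wd]

theorem card_Wd {α : Type} [Fintype α] (ℓ : ℕ) (A : Finset α) :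
    (Wd ℓ A).card = A.card.factorial * S ℓ A.card := by
  classical
  have := card_surj_eq (β := A) ℓ
  rw [Fintype.card_coe] at this
  rw [← this, show (Wd ℓ A).card = Nat.card (Wd ℓ A : Set (List α)) by simp]
  symm
  let Φ : {f : Fin ℓ → A // Function.Surjective f} → (Wd ℓ A : Set (List α)) :=
    fun f => ⟨List.ofFn (fun i => (f.1 i : α)), by
      simp only [Finset.mem_coe, mem_Wd, List.length_ofFn, List.mem_ofFn, true_and]
      intro x
      constructor
      · rintro ⟨i, rfl⟩
        exact (f.1 i).2
      · intro hx
        obtain ⟨i, hi⟩ := f.2 ⟨x, hx⟩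
        exact ⟨i, by simp [hi]⟩⟩
  apply Nat.card_eq_of_bijective Φ
  constructor
  · intro f g h
    have := List.ofFn_injective (congrArg Subtype.val h)
    apply Subtype.ext
    funext i
    exact Subtype.ext (congrFun this i)
  · rintro ⟨l, hl⟩
    have hl2 := hl
    simp only [Finset.mem_coe, mem_Wd] at hl2
    obtain ⟨rfl, hl2⟩ := hl2
    refine ⟨⟨fun i => ⟨l.get i, (hl2 _).1 (List.get_mem _ _)⟩, ?_⟩, ?_⟩
    · rintro ⟨x, hx⟩
      obtain ⟨i, hi⟩ := List.get_of_mem ((hl2 x).2 hx)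
      exact ⟨i, Subtype.ext hi⟩
    · apply Subtype.ext
      simp [Φ]

theorem card_Wd_rec {α : Type} [Fintype α] [DecidableEq α] (L : ℕ) (hL : 1 ≤ L) (A : Finset α) :
    (Wd L A).card = ∑ j ∈ Finset.range L, ∑ B ∈ A.powerset,
      (Wd j B).card * (Wi (L - j) (A \ B)).card := by
  classical
  rw [← Finset.sum_product']
  simp_rw [← Finset.card_product]
  rw [← Finset.card_sigma]
  symm
  refine Finset.card_bij (fun x _ => x.2.1 ++ x.2.2) ?_ ?_ ?_
  · rintro ⟨⟨j, B⟩, ⟨u, v⟩⟩ h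
    simp only [Finset.mem_sigma, Finset.mem_product, Finset.mem_range, Finset.mem_powerset,
      mem_Wd, mem_Wi] at h ⊢
    obtain ⟨⟨hj, hB⟩, ⟨hu, hu'⟩, ⟨hv, hv'⟩, hi⟩ := h
    refine ⟨by simp; omega, fun x => ?_⟩
    have := @hB x
    rw [List.mem_append, hu', hv', Finset.mem_sdiff]
    tauto
  · rintro ⟨⟨j, B⟩, ⟨u, v⟩⟩ h ⟨⟨j', B'⟩, ⟨u', v'⟩⟩ h' heq
    simp only [Finset.mem_sigma, Finset.mem_product, Finset.mem_range, Finset.mem_powerset,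
      mem_Wd, mem_Wi] at h h' heq
    obtain ⟨⟨hj, hB⟩, ⟨hu, hu'⟩, ⟨hv, hv'⟩, hi⟩ := h
    obtain ⟨⟨kj, kB⟩, ⟨ku, ku'⟩, ⟨kv, kv'⟩, ki⟩ := h'
    obtain ⟨rfl, rfl⟩ := split_unique u v u' v' heq
      (by rintro rfl; simp at hv; omega) hi
      (by intro x hx hx'; simp only [hu', hv', Finset.mem_sdiff] at hx hx'; tauto)
      (by rintro rfl; simp at kv; omega) ki
      (by intro x hx hx'; simp only [ku', kv', Finset.mem_sdiff] at hx hx'; tauto)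
    have : B = B' := by ext x; rw [← hu', ← ku']
    subst hu
    subst ku
    subst this
    rfl
  · intro w hw
    rw [mem_Wd] at hw
    obtain ⟨hw, hwA⟩ := hw
    obtain ⟨u, v, rfl, hv, hi, hd⟩ := exists_split w (by rintro rfl; simp at hw; omega)
    have hvl := List.length_pos_iff.2 hv
    rw [List.length_append] at hw
    simp only [List.mem_append] at hwA
    refine ⟨⟨⟨u.length, u.toFinset⟩, ⟨u, v⟩⟩, ?_, rfl⟩
    simp only [Finset.mem_sigma, Finset.mem_product, Finset.mem_range, Finset.mem_powerset,
      mem_Wd, mem_Wi, List.mem_toFinset, Finset.mem_sdiff, true_and, implies_true]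
    refine ⟨⟨by omega, fun x hx => ?_⟩, ⟨by omega, fun x => ?_⟩, hi⟩
    · rw [← hwA]; left; simpa using hx
    · rw [← hwA]
      have := @hd x
      tauto

theorem card_Wi_rec {α : Type} [Fintype α] [DecidableEq α] (L : ℕ) (hL : 1 ≤ L) (A : Finset α) :
    (Wi (L + 1) A).card = ∑ j ∈ Finset.range L, ∑ B ∈ A.powerset,
      (Wd j B).card * (Wi (L - j) (A \ B)).card * (A \ B).card := by
  classical
  rw [← Finset.sum_product']
  simp_rw [← Finset.card_product]
  rw [← Finset.card_sigma]
  symm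
  refine Finset.card_bij (fun x _ => x.2.2 :: (x.2.1.1 ++ x.2.1.2)) ?_ ?_ ?_
  · rintro ⟨⟨j, B⟩, ⟨⟨u, v⟩, a⟩⟩ h
    simp only [Finset.mem_sigma, Finset.mem_product, Finset.mem_range, Finset.mem_powerset,
      mem_Wd, mem_Wi] at h ⊢
    obtain ⟨⟨hj, hB⟩, ⟨⟨hu, hu'⟩, ⟨hv, hv'⟩, hi⟩, ha⟩ := h
    refine ⟨⟨by simp; omega, fun x => ?_⟩, ?_⟩
    · have := @hB x
      rw [List.mem_cons, List.mem_append, hu', hv', Finset.mem_sdiff]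
      rw [Finset.mem_sdiff] at ha
      constructor
      · rintro (rfl | h)
        · exact ha.1
        · tauto
      · tauto
    · rw [irr_cons]
      · rwa [hv']
      · rintro rfl; simp at hv; omega
      · exact hi
      · intro x hx hx'; simp only [hu', hv', Finset.mem_sdiff] at hx hx'; tauto
  · rintro ⟨⟨j, B⟩, ⟨⟨u, v⟩, a⟩⟩ h ⟨⟨j', B'⟩, ⟨⟨u', v'⟩, a'⟩⟩ h' heq
    simp only [Finset.mem_sigma, Finset.mem_product, Finset.mem_range, Finset.mem_powerset,
      mem_Wd, mem_Wi, List.cons.injEq] at h h' heq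
    obtain ⟨⟨hj, hB⟩, ⟨⟨hu, hu'⟩, ⟨hv, hv'⟩, hi⟩, ha⟩ := h
    obtain ⟨⟨kj, kB⟩, ⟨⟨ku, ku'⟩, ⟨kv, kv'⟩, ki⟩, ka⟩ := h'
    obtain ⟨rfl, heq⟩ := heq
    obtain ⟨rfl, rfl⟩ := split_unique u v u' v' heq
      (by rintro rfl; simp at hv; omega) hi
      (by intro x hx hx'; simp only [hu', hv', Finset.mem_sdiff] at hx hx'; tauto)
      (by rintro rfl; simp at kv; omega) ki
      (by intro x hx hx'; simp only [ku', kv', Finset.mem_sdiff] at hx hx'; tauto)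
    have : B = B' := by ext x; rw [← hu', ← ku']
    subst hu
    subst ku
    subst this
    rfl
  · intro w hw
    rw [mem_Wi] at hw
    obtain ⟨⟨hw, hwA⟩, hirr⟩ := hw
    cases w with
    | nil => simp at hw
    | cons a w =>
    obtain ⟨u, v, rfl, hv, hi, hd⟩ := exists_split w (by rintro rfl; simp at hw; omega)
    have hvl := List.length_pos_iff.2 hv
    rw [irr_cons a u v hv hi hd] at hirr
    rw [List.length_cons, List.length_append] at hw
    simp only [List.mem_append, List.mem_cons] at hwA
    refine ⟨⟨⟨u.length, u.toFinset⟩, ⟨⟨u, v⟩, a⟩⟩, ?_, rfl⟩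
    simp only [Finset.mem_sigma, Finset.mem_product, Finset.mem_range, Finset.mem_powerset,
      mem_Wd, mem_Wi, List.mem_toFinset, Finset.mem_sdiff, true_and, implies_true]
    refine ⟨⟨by omega, fun x hx => ?_⟩, ⟨⟨by omega, fun x => ?_⟩, hi⟩, ?_, ?_⟩
    · rw [← hwA]; right; left; simpa using hx
    · rw [← hwA]
      have := @hd x
      constructor
      · tauto
      · rintro ⟨rfl | h, h'⟩
        · exact hirr
        · tauto
    · rw [← hwA]; left; rfl
    · exact fun h => hd h hirr

theorem card_Wi {α : Type} [Fintype α] (T : ℕ → ℕ → ℕ)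
    (hT1 : ∀ ℓ : ℕ, 1 ≤ ℓ → T ℓ 1 = 1)
    (hT0 : ∀ ℓ n : ℕ, (n = 0 ∨ (2 ≤ n ∧ ℓ ≤ n)) → T ℓ n = 0)
    (hTrec : ∀ ℓ n : ℕ, 2 ≤ n → n < ℓ →
      T ℓ n = S (ℓ - 1) n +
        ∑ j ∈ Finset.range (ℓ - 1), ∑ m ∈ Finset.range (n - 1),
          S j m * T (ℓ - j - 1) (n - m) * (n - m - 1))
    (ℓ : ℕ) : ∀ (A : Finset α), 1 ≤ ℓ → (Wi ℓ A).card = A.card.factorial * T ℓ A.card := by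
  classical
  induction ℓ using Nat.strong_induction_on with
  | _ ℓ ih =>
  intro A hℓ
  rcases Nat.lt_or_ge A.card 2 with hA | hA
  · rcases (by omega : A.card = 0 ∨ A.card = 1) with h0 | h1
    · rw [h0, hT0 ℓ 0 (Or.inl rfl), mul_zero, Finset.card_eq_zero,
        Finset.eq_empty_iff_forall_notMem]
      intro l hl
      rw [mem_Wi] at hl
      rw [Finset.card_eq_zero] at h0
      subst h0
      cases l with
      | nil => simp at hl; omega
      | cons a l => exact absurd ((hl.1.2 a).1 (by simp)) (by simp)
    · rw [h1, hT1 ℓ hℓ]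
      obtain ⟨a, rfl⟩ := Finset.card_eq_one.1 h1
      simp only [Nat.factorial_one, mul_one]
      rw [Finset.card_eq_one]
      refine ⟨List.replicate ℓ a, ?_⟩
      ext l
      rw [mem_Wi, Finset.mem_singleton]
      constructor
      · rintro ⟨⟨h, h'⟩, _⟩
        rw [List.eq_replicate_iff]
        exact ⟨h, fun b hb => by simpa using (h' b).1 hb⟩
      · rintro rfl
        refine ⟨⟨by simp, fun x => ?_⟩, ?_⟩
        · rw [List.mem_replicate]
          simp
          omega
        · intro u v hu hv h
          obtain ⟨x, hx⟩ := List.exists_mem_of_ne_nil u hu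
          obtain ⟨y, hy⟩ := List.exists_mem_of_ne_nil v hv
          have hx' : x ∈ List.replicate ℓ a := by rw [h]; simp [hx]
          have hy' : y ∈ List.replicate ℓ a := by rw [h]; simp [hy]
          rw [List.mem_replicate] at hx' hy'
          obtain rfl := hx'.2
          obtain rfl := hy'.2
          exact ⟨_, hx, hy⟩
  · rcases Nat.lt_or_ge A.card ℓ with hlt | hge
    · obtain ⟨L, rfl⟩ : ∃ L, ℓ = L + 1 := ⟨ℓ - 1, by omega⟩
      have hL : 1 ≤ L := by omega
      set n := A.card with hn
      -- the two weighted sums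
      have key : ∀ f : ℕ → ℕ, ∑ j ∈ Finset.range L, ∑ B ∈ A.powerset,
          (Wd j B).card * (Wi (L - j) (A \ B)).card * f (A \ B).card =
          n.factorial * ∑ j ∈ Finset.range L, ∑ m ∈ Finset.range (n - 1 + 1),
            S j m * T (L - j) (n - m) * f (n - m) := by
        intro f
        rw [Finset.mul_sum]
        refine Finset.sum_congr rfl fun j hj => ?_
        rw [Finset.mem_range] at hj
        have h1 : ∀ B ∈ A.powerset, (Wd j B).card * (Wi (L - j) (A \ B)).card * f (A \ B).card =
            (fun m => m.factorial * S j m * ((n - m).factorial * T (L - j) (n - m)) * f (n - m))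
              B.card := by
          intro B hB
          rw [Finset.mem_powerset] at hB
          rw [card_Wd, ih (L - j) (by omega) _ (by omega), Finset.card_sdiff_of_subset hB]
        refine (Finset.sum_congr rfl h1).trans ((Finset.sum_powerset_apply_card
          (fun m => m.factorial * S j m * ((n - m).factorial * T (L - j) (n - m)) * f (n - m))).trans ?_)
        rw [Finset.mul_sum, Finset.sum_range_succ]
        rw [← hn, Nat.sub_self, hT0 (L - j) 0 (Or.inl rfl)]
        simp only [mul_zero, zero_mul, smul_zero, add_zero]
        rw [show n - 1 + 1 = n by omega]
        refine Finset.sum_congr rfl fun m hm => ?_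
        rw [Finset.mem_range] at hm
        rw [← Nat.choose_mul_factorial_mul_factorial hm.le, smul_eq_mul]
        ring
      have kW := key (fun _ => 1)
      have kI := key (fun k => k)
      simp only [mul_one] at kW
      rw [← card_Wd_rec L hL A, card_Wd] at kW
      rw [← card_Wi_rec L hL A] at kI
      rw [kI]
      have hS := Nat.eq_of_mul_eq_mul_left (Nat.factorial_pos n) kW
      rw [hTrec (L + 1) n hA hlt, Nat.add_sub_cancel, hS, ← Finset.sum_add_distrib]
      congr 1
      refine Finset.sum_congr rfl fun j hj => ?_
      rw [show L + 1 - j - 1 = L - j by omega]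
      have h2 : ∑ m ∈ Finset.range (n - 1), S j m * T (L - j) (n - m) * (n - m - 1) =
          ∑ m ∈ Finset.range (n - 1 + 1), S j m * T (L - j) (n - m) * (n - m - 1) := by
        rw [Finset.sum_range_succ, show n - (n - 1) - 1 = 0 by omega]
        simp
      rw [h2, ← Finset.sum_add_distrib]
      refine Finset.sum_congr rfl fun m hm => ?_
      rw [Finset.mem_range] at hm
      obtain ⟨k, hk⟩ : ∃ k, n - m = k + 1 := ⟨n - m - 1, by omega⟩
      rw [hk, Nat.add_sub_cancel]
      ring
    · rw [hT0 ℓ A.card (Or.inr ⟨hA, hge⟩), mul_zero, Finset.card_eq_zero,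
        Finset.eq_empty_iff_forall_notMem]
      intro l hl
      rw [mem_Wi] at hl
      obtain ⟨⟨h1, h2⟩, h3⟩ := hl
      have hlA : l.toFinset = A := by ext x; simp [h2]
      have hle := List.toFinset_card_le l
      have hnd : l.Nodup := by
        rw [← Multiset.coe_nodup, ← Multiset.toFinset_card_eq_card_iff_nodup]
        change l.toFinset.card = l.length
        rw [hlA] at hle ⊢
        omega
      rw [hlA] at hle
      match l, hnd, h3 with
      | [], _, _ => simp only [List.length_nil] at hle; omega
      | [a], _, _ => simp only [List.length_cons, List.length_nil] at hle; omega
      | a :: b :: l, hnd, h3 =>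
        obtain ⟨x, hx, hx'⟩ := h3 [a] (b :: l) (by simp) (by simp) rfl
        rw [List.mem_singleton] at hx
        subst hx
        exact (List.nodup_cons.1 hnd).1 hx'

theorem strong_iff_irr {ℓ : ℕ} {α : Type} (ω : Fin ℓ → α) :
    StronglyConnectedWord ω ↔ Irr (List.ofFn ω) := by
  constructor
  · intro h u v hu hv huv
    by_contra hcon
    push Not at hcon
    have hlen : ℓ = u.length + v.length := by
      have := congrArg List.length huv
      simpa using this
    have hget : ∀ (i : ℕ) (hi : i < ℓ), (u ++ v)[i]'(by simp; omega) = ω ⟨i, hi⟩ := by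
      intro i hi
      simp [← huv]
    have hu' := List.length_pos_iff.2 hu
    have hv' := List.length_pos_iff.2 hv
    have hmem : ∀ (i : ℕ) (hi : i < ℓ), u.length ≤ i → ω ⟨i, hi⟩ ∈ v := by
      intro i hi hle
      rw [← hget, List.getElem_append_right hle]
      exact List.getElem_mem _
    have hmem' : ∀ (i : ℕ) (hi : i < ℓ), i < u.length → ω ⟨i, hi⟩ ∈ u := by
      intro i hi hle
      rw [← hget, List.getElem_append_left hle]
      exact List.getElem_mem _
    have hclosed : ∀ a b, Relation.ReflTransGen (WordEdge ω) a b → a ∈ v → b ∈ v := by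
      intro a b hab ha
      induction hab with
      | refl => exact ha
      | tail _ hbc ih =>
        obtain ⟨_, i, hi, rfl, rfl⟩ := hbc
        apply hmem
        by_contra hlt
        exact hcon _ (hmem' i (by omega) (by omega)) ih
    have h0 := hclosed _ _ (h (ω ⟨u.length, by omega⟩) ⟨_, rfl⟩ (ω ⟨0, by omega⟩) ⟨_, rfl⟩)
      (hmem _ _ le_rfl)
    exact hcon _ (hmem' 0 (by omega) hu') h0
  · rintro h a ⟨ia, rfl⟩ b ⟨ib, rfl⟩
    classical
    let R : ℕ → Prop := fun i => ∃ hi : i < ℓ, Relation.ReflTransGen (WordEdge ω) (ω ia) (ω ⟨i, hi⟩)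
    have hex : ∃ i, R i := ⟨ia, ia.2, Relation.ReflTransGen.refl⟩
    have hstep : ∀ i, R i → i + 1 < ℓ → R (i + 1) := by
      rintro i ⟨hi, hr⟩ hi'
      refine ⟨hi', ?_⟩
      by_cases heq : ω ⟨i, hi⟩ = ω ⟨i + 1, hi'⟩
      · rwa [← heq]
      · exact hr.tail ⟨heq, i, hi', rfl, rfl⟩
    obtain ⟨hk, hr⟩ := Nat.find_spec hex
    have hmin : ∀ i, R i → Nat.find hex ≤ i := fun i hi => Nat.find_min' hex hi
    have hRk : R (Nat.find hex) := ⟨hk, hr⟩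
    generalize Nat.find hex = k at *
    have hup : ∀ i, k ≤ i → i < ℓ → R i := by
      intro i hki
      induction i, hki using Nat.le_induction with
      | base => intro _; exact hRk
      | succ i _ ih => intro hi; exact hstep i (ih (by omega)) hi
    by_cases hk0 : k = 0
    · obtain ⟨_, h'⟩ := hup ib (by omega) ib.2
      exact h'
    · exfalso
      obtain ⟨x, hx, hx'⟩ := h ((List.ofFn ω).take k) ((List.ofFn ω).drop k)
        (by rw [← List.length_pos_iff]; simp; omega)
        (by rw [← List.length_pos_iff]; simp; omega) (by simp)
      obtain ⟨i, hi, rfl⟩ := List.getElem_of_mem hx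
      obtain ⟨j, hj, hij⟩ := List.getElem_of_mem hx'
      simp at hi hj hij
      obtain ⟨hj', hr'⟩ := hup (k + j) (by omega) (by omega)
      rw [hij] at hr'
      have := hmin i ⟨by omega, hr'⟩
      omega

/-- If `T` satisfies `T(ℓ,1) = 1` for `ℓ ≥ 1`, `T(ℓ,n) = 0` for `n = 0` or `2 ≤ n` with
`ℓ ≤ n`, and the Stirling-number recurrence for `ℓ > n ≥ 2`, then for all `ℓ > n ≥ 1` the
number of surjective words `Fin ℓ → Fin n` with strongly connected word-graph is
`n! · T(ℓ, n)`. -/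
theorem card_stronglyConnected_words_eq_T (T : ℕ → ℕ → ℕ)
    (hT1 : ∀ ℓ : ℕ, 1 ≤ ℓ → T ℓ 1 = 1)
    (hT0 : ∀ ℓ n : ℕ, (n = 0 ∨ (2 ≤ n ∧ ℓ ≤ n)) → T ℓ n = 0)
    (hTrec : ∀ ℓ n : ℕ, 2 ≤ n → n < ℓ →
      T ℓ n = S (ℓ - 1) n +
        ∑ j ∈ Finset.range (ℓ - 1), ∑ m ∈ Finset.range (n - 1),
          S j m * T (ℓ - j - 1) (n - m) * (n - m - 1))
    (ℓ n : ℕ) (hn : 1 ≤ n) (hℓ : n < ℓ) :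
    Nat.card {ω : Fin ℓ → Fin n // Function.Surjective ω ∧ StronglyConnectedWord ω}
      = n.factorial * T ℓ n := by
  have hcard := card_Wi (α := Fin n) T hT1 hT0 hTrec ℓ Finset.univ (by omega)
  rw [Finset.card_univ, Fintype.card_fin] at hcard
  rw [← hcard, show (Wi ℓ (Finset.univ : Finset (Fin n))).card =
    Nat.card ((Wi ℓ Finset.univ : Finset (List (Fin n))) : Set (List (Fin n))) by simp]
  let Φ : {ω : Fin ℓ → Fin n // Function.Surjective ω ∧ StronglyConnectedWord ω} →
      ((Wi ℓ Finset.univ : Finset (List (Fin n))) : Set (List (Fin n))) :=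
    fun f => ⟨List.ofFn f.1, by
      simp only [Finset.mem_coe, mem_Wi, List.length_ofFn, List.mem_ofFn, true_and,
        Finset.mem_univ, iff_true]
      exact ⟨fun x => f.2.1 x, (strong_iff_irr _).1 f.2.2⟩⟩
  apply Nat.card_eq_of_bijective Φ
  constructor
  · intro f g h
    exact Subtype.ext (List.ofFn_injective (congrArg Subtype.val h))
  · rintro ⟨l, hl⟩
    have hl2 := hl
    simp only [Finset.mem_coe, mem_Wi] at hl2
    obtain ⟨⟨rfl, hl2⟩, hi⟩ := hl2
    refine ⟨⟨l.get, fun x => ?_, ?_⟩, ?_⟩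
    · exact List.get_of_mem ((hl2 x).2 (Finset.mem_univ x))
    · rw [strong_iff_irr]
      simpa using hi
    · apply Subtype.ext
      simp [Φ]
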